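/- The set 𝔯 of representable operators from L₁[0,1] to itself is a closed two-sided ideal in the Banach algebra B(L₁[0,1]): it is a norm-closed linear subspace, and for every T ∈ 𝔯 and every bounded operator S on L₁[0,1], both S∘T and T∘S belong to 𝔯. -/

import Mathlib

open scoped TensorProduct ENNReal
open MeasureTheory Filter

noncomputable section

/-- Lebesgue measure on `ℝ` restricted to the unit interval `[0,1]`. -/
def μ01 : Measure ℝ := volume.restrict (Set.Icc 0 1)

/-- The complex Lebesgue space `L₁[0,1]`. -/
abbrev L1C : Type := Lp ℂ 1 μ01

/-- An operator `T : L₁[0,1] → E` is representable if there is a bounded, strongly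
measurable `h : [0,1] → E` such that `T f = ∫₀¹ f(s) • h(s) ds` (a Bochner integral). -/
def IsRepresentable {E : Type*} [NormedAddCommGroup E] [NormedSpace ℂ E]
    (T : L1C →L[ℂ] E) : Prop :=
  ∃ h : ℝ → E, StronglyMeasurable h ∧ (∃ C : ℝ, ∀ t ∈ Set.Icc (0:ℝ) 1, ‖h t‖ ≤ C) ∧
    ∀ f : L1C, T f = ∫ s, (f : ℝ → ℂ) s • h s ∂μ01

instance : IsFiniteMeasure μ01 := by unfold μ01; infer_instance

lemma ae_mem_Icc_μ01 : ∀ᵐ t ∂μ01, t ∈ Set.Icc (0 : ℝ) 1 :=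
  ae_restrict_mem measurableSet_Icc

section General

variable {E : Type*} [NormedAddCommGroup E] [NormedSpace ℂ E]

lemma integrable_L1C_smul {h : ℝ → E} (hh : AEStronglyMeasurable h μ01) {C : ℝ}
    (hC : ∀ᵐ t ∂μ01, ‖h t‖ ≤ C) (f : L1C) :
    Integrable (fun s => (f : ℝ → ℂ) s • h s) μ01 :=
  (L1.integrable_coeFn f).smul_bdd C hh hC

/-- The operator on `L₁[0,1]` with essentially bounded density `h`. -/
lemma exists_clm_of_density {h : ℝ → E} (hh : AEStronglyMeasurable h μ01) {C : ℝ} (hC0 : 0 ≤ C)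
    (hC : ∀ᵐ t ∂μ01, ‖h t‖ ≤ C) :
    ∃ T : L1C →L[ℂ] E, (∀ f : L1C, T f = ∫ s, (f : ℝ → ℂ) s • h s ∂μ01) ∧ ‖T‖ ≤ C := by
  let T₀ : L1C →ₗ[ℂ] E :=
    { toFun := fun f => ∫ s, (f : ℝ → ℂ) s • h s ∂μ01
      map_add' := fun f g => by
        rw [← integral_add (integrable_L1C_smul hh hC f) (integrable_L1C_smul hh hC g)]
        refine integral_congr_ae ?_
        filter_upwards [Lp.coeFn_add f g] with t ht
        rw [ht, Pi.add_apply, add_smul]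
      map_smul' := fun c f => by
        rw [RingHom.id_apply, ← integral_smul]
        refine integral_congr_ae ?_
        filter_upwards [Lp.coeFn_smul c f] with t ht
        rw [ht, Pi.smul_apply, smul_eq_mul, mul_smul] }
  have hT₀ : ∀ f, ‖T₀ f‖ ≤ C * ‖f‖ := fun f => by
    rw [L1.norm_eq_integral_norm, ← integral_const_mul]
    refine norm_integral_le_of_norm_le ((L1.integrable_coeFn f).norm.const_mul C) ?_
    filter_upwards [hC] with t ht
    rw [norm_smul, mul_comm]
    gcongr
  exact ⟨T₀.mkContinuous C hT₀, fun f => rfl, T₀.mkContinuous_norm_le hC0 hT₀⟩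

/-- A representation by an essentially bounded density yields one by a bounded density. -/
lemma isRepresentable_of_ae_bound {T : L1C →L[ℂ] E} {h : ℝ → E} (hh : StronglyMeasurable h)
    {C : ℝ} (hC : ∀ᵐ t ∂μ01, ‖h t‖ ≤ C)
    (hT : ∀ f : L1C, T f = ∫ s, (f : ℝ → ℂ) s • h s ∂μ01) : IsRepresentable T := by
  refine ⟨{t | ‖h t‖ ≤ C}.indicator h,
    hh.indicator (measurableSet_le hh.norm.measurable measurable_const), ⟨max C 0, ?_⟩, ?_⟩
  · intro t _
    by_cases ht : t ∈ {t | ‖h t‖ ≤ C}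
    · rw [Set.indicator_of_mem ht]; exact ht.trans (le_max_left _ _)
    · rw [Set.indicator_of_notMem ht, norm_zero]; exact le_max_right _ _
  · intro f
    rw [hT f]
    refine integral_congr_ae ?_
    filter_upwards [hC] with t ht
    rw [Set.indicator_of_mem (show t ∈ {t | ‖h t‖ ≤ C} from ht)]

lemma IsRepresentable.exists_ae_bound {T : L1C →L[ℂ] E} (hT : IsRepresentable T) :
    ∃ h : ℝ → E, StronglyMeasurable h ∧ (∃ C : ℝ, 0 ≤ C ∧ ∀ᵐ t ∂μ01, ‖h t‖ ≤ C) ∧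
      ∀ f : L1C, T f = ∫ s, (f : ℝ → ℂ) s • h s ∂μ01 := by
  obtain ⟨h, hh, ⟨C, hC⟩, hT⟩ := hT
  refine ⟨h, hh, ⟨C, (norm_nonneg _).trans (hC 0 (by simp)), ?_⟩, hT⟩
  filter_upwards [ae_mem_Icc_μ01] with t ht using hC t ht

lemma isRepresentable_zero : IsRepresentable (0 : L1C →L[ℂ] E) :=
  ⟨0, stronglyMeasurable_zero, ⟨0, by simp⟩, by simp⟩

lemma IsRepresentable.add {T S : L1C →L[ℂ] E} (hT : IsRepresentable T) (hS : IsRepresentable S) :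
    IsRepresentable (T + S) := by
  obtain ⟨h, hh, ⟨C, -, hC⟩, hT⟩ := hT.exists_ae_bound
  obtain ⟨k, hk, ⟨D, -, hD⟩, hS⟩ := hS.exists_ae_bound
  refine isRepresentable_of_ae_bound (hh.add hk) (C := C + D) ?_ fun f => ?_
  · filter_upwards [hC, hD] with t h₁ h₂ using (norm_add_le _ _).trans (add_le_add h₁ h₂)
  · rw [add_apply, hT, hS,
      ← integral_add (integrable_L1C_smul hh.aestronglyMeasurable hC f)
        (integrable_L1C_smul hk.aestronglyMeasurable hD f)]
    simp only [Pi.add_apply, smul_add]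

lemma IsRepresentable.clm_comp {F : Type*} [NormedAddCommGroup F] [NormedSpace ℂ F]
    [CompleteSpace E] [CompleteSpace F] {T : L1C →L[ℂ] E} (hT : IsRepresentable T)
    (S : E →L[ℂ] F) : IsRepresentable (S.comp T) := by
  obtain ⟨h, hh, ⟨C, -, hC⟩, hT⟩ := hT.exists_ae_bound
  refine isRepresentable_of_ae_bound (S.continuous.comp_stronglyMeasurable hh)
    (C := ‖S‖ * C) ?_ fun f => ?_
  · filter_upwards [hC] with t ht using S.le_opNorm_of_le ht
  · rw [ContinuousLinearMap.comp_apply, hT,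
      ← S.integral_comp_comm (integrable_L1C_smul hh.aestronglyMeasurable hC f)]
    simp only [map_smul]

lemma IsRepresentable.smul [CompleteSpace E] {T : L1C →L[ℂ] E} (hT : IsRepresentable T) (c : ℂ) :
    IsRepresentable (c • T) := by
  have := hT.clm_comp (c • ContinuousLinearMap.id ℂ E)
  rwa [ContinuousLinearMap.smul_comp, ContinuousLinearMap.id_comp] at this

/-- Lebesgue differentiation: bounds on the sums of norms of the integrals over measurable sets
give pointwise bounds on the sums of norms. -/
lemma ae_sum_norm_le_of_forall_setIntegral {ι : Type*} [Countable ι] [CompleteSpace E]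
    {h : ι → ℝ → E} (hh : ∀ i, Integrable (h i) μ01) {C : ℝ} (hC0 : 0 ≤ C)
    (hC : ∀ a, MeasurableSet a → ∀ s : Finset ι,
      ∑ i ∈ s, ‖∫ t in a, h i t ∂μ01‖ ≤ C * μ01.real a) :
    ∀ᵐ t ∂μ01, ∀ s : Finset ι, ∑ i ∈ s, ‖h i t‖ ≤ C := by
  let v := Besicovitch.vitaliFamily μ01
  filter_upwards [ae_all_iff.2 fun i => v.ae_tendsto_average (hh i).locallyIntegrable]
    with t ht s
  refine le_of_tendsto (tendsto_finsetSum s fun i _ => (ht i).norm) ?_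
  filter_upwards [v.eventually_filterAt_measurableSet t] with a ha
  simp only [setAverage_eq, norm_smul, ← Finset.mul_sum, norm_inv,
    Real.norm_of_nonneg (measureReal_nonneg (μ := μ01) (s := a))]
  rcases (measureReal_nonneg (μ := μ01) (s := a)).eq_or_lt with h0 | h0
  · simpa [← h0] using hC0
  · rw [inv_mul_le_iff₀ h0, mul_comm]
    exact hC a ha s

lemma integral_indicatorConstLp_smul (h : ℝ → E) {a : Set ℝ} (ha : MeasurableSet a)
    (c : ℂ) : ∫ s, (indicatorConstLp 1 ha (measure_ne_top μ01 a) c : ℝ → ℂ) s • h s ∂μ01 =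
      c • ∫ s in a, h s ∂μ01 := by
  rw [← integral_smul, ← integral_indicator ha]
  refine integral_congr_ae ?_
  filter_upwards [indicatorConstLp_coeFn (p := 1) (hs := ha) (hμs := measure_ne_top μ01 a)
    (c := c)] with t ht
  rw [ht]
  by_cases h' : t ∈ a <;> simp [h']

lemma norm_indicatorConstLp_one_le {a : Set ℝ} (ha : MeasurableSet a) :
    ‖indicatorConstLp 1 ha (measure_ne_top μ01 a) (1 : ℂ)‖ ≤ μ01.real a := by
  simp [norm_indicatorConstLp one_ne_zero ENNReal.one_ne_top]

/-- A strongly convergent series of representable operators, absolutely convergent in the sense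
that `∑ ‖Tᵢ f‖ ≤ C ‖f‖`, has a representable sum. -/
lemma isRepresentable_of_hasSum {ι : Type*} [Countable ι] [CompleteSpace E]
    {U : ι → L1C →L[ℂ] E} {T : L1C →L[ℂ] E} (hU : ∀ i, IsRepresentable (U i))
    (hT : ∀ f, HasSum (fun i => U i f) (T f)) {C : ℝ} (hC0 : 0 ≤ C)
    (hC : ∀ f, ∀ s : Finset ι, ∑ i ∈ s, ‖U i f‖ ≤ C * ‖f‖) : IsRepresentable T := by
  have hrep := fun i => (hU i).exists_ae_bound
  choose h hh hD hU using hrep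
  choose D hD using hD
  have hint : ∀ i, Integrable (h i) μ01 := fun i =>
    .of_bound (hh i).aestronglyMeasurable (D i) (hD i).2
  have key : ∀ᵐ t ∂μ01, ∀ s : Finset ι, ∑ i ∈ s, ‖h i t‖ ≤ C := by
    refine ae_sum_norm_le_of_forall_setIntegral hint hC0 fun a ha s => ?_
    refine le_trans (le_of_eq ?_) ((hC (indicatorConstLp 1 ha (measure_ne_top μ01 a) 1) s).trans
      (mul_le_mul_of_nonneg_left (norm_indicatorConstLp_one_le ha) hC0))
    refine Finset.sum_congr rfl fun i _ => ?_
    rw [hU, integral_indicatorConstLp_smul, one_smul]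
  have hsum : ∀ᵐ t ∂μ01, Summable fun i => ‖h i t‖ := by
    filter_upwards [key] with t ht
    exact summable_of_sum_le (fun _ => norm_nonneg _) ht
  refine isRepresentable_of_ae_bound (StronglyMeasurable.tsum (L := .unconditional ι) hh) (C := C) ?_ fun f => ?_
  · filter_upwards [key, hsum] with t ht hs
    exact (norm_tsum_le_tsum_norm hs).trans (hs.tsum_le_of_sum_le ht)
  · refine (hT f).unique ?_
    simp only [hU]
    have hb : ∀ t, (∑' i, ‖(f : ℝ → ℂ) t‖ * ‖h i t‖) = ‖(f : ℝ → ℂ) t‖ * ∑' i, ‖h i t‖ :=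
      fun t => tsum_mul_left
    refine hasSum_integral_of_dominated_convergence
      (fun i t => ‖(f : ℝ → ℂ) t‖ * ‖h i t‖)
      (fun i => (integrable_L1C_smul (hh i).aestronglyMeasurable (hD i).2 f).aestronglyMeasurable)
      (fun i => .of_forall fun t => (norm_smul _ _).le) ?_ ?_ ?_
    · filter_upwards [hsum] with t ht using ht.mul_left _
    · simp only [hb]
      refine (L1.integrable_coeFn f).norm.mul_bdd (c := C)
        (StronglyMeasurable.tsum (L := .unconditional ι) fun i => (hh i).norm).aestronglyMeasurable ?_
      filter_upwards [key, hsum] with t ht hs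
      rw [Real.norm_of_nonneg (tsum_nonneg fun _ => norm_nonneg _)]
      exact hs.tsum_le_of_sum_le ht
    · filter_upwards [hsum] with t ht
      exact (ht.of_norm.hasSum).const_smul _

lemma isClosed_setOf_isRepresentable [CompleteSpace E] :
    IsClosed {T : L1C →L[ℂ] E | IsRepresentable T} := by
  refine isClosed_of_closure_subset fun T hT => ?_
  have : ∀ n : ℕ, ∃ R : L1C →L[ℂ] E, IsRepresentable R ∧ ‖T - R‖ < (1 / 2) ^ n := fun n => by
    obtain ⟨R, hR, hd⟩ := Metric.mem_closure_iff.1 hT ((1 / 2) ^ n) (by positivity)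
    exact ⟨R, hR, by rwa [← dist_eq_norm]⟩
  choose R hR hd using this
  have hstep : ∀ n, ‖R (n + 1) - R n‖ ≤ 2 * (1 / 2) ^ n := fun n => by
    have h₁ := hd n
    have h₂ := hd (n + 1)
    have h₃ : (1 / 2 : ℝ) ^ (n + 1) ≤ (1 / 2) ^ n :=
      pow_le_pow_of_le_one (by norm_num) (by norm_num) n.le_succ
    calc ‖R (n + 1) - R n‖ = ‖(T - R n) - (T - R (n + 1))‖ := by congr 1; abel
      _ ≤ ‖T - R n‖ + ‖T - R (n + 1)‖ := norm_sub_le _ _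
      _ ≤ 2 * (1 / 2) ^ n := by linarith
  have hgeom : HasSum (fun n : ℕ => 2 * (1 / 2 : ℝ) ^ n) (2 * 2) := hasSum_geometric_two.mul_left 2
  have hlim : Tendsto R atTop (nhds T) := by
    rw [tendsto_iff_norm_sub_tendsto_zero]
    refine squeeze_zero (fun _ => norm_nonneg _)
      (fun n => (norm_sub_rev (R n) T).le.trans (hd n).le)
      (tendsto_pow_atTop_nhds_zero_of_lt_one (by norm_num) (by norm_num))
  have hbound : ∀ (f : L1C) (n : ℕ), ‖(R (n + 1) - R n) f‖ ≤ 2 * (1 / 2) ^ n * ‖f‖ := fun f n =>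
    (R (n + 1) - R n).le_of_opNorm_le (hstep n) f
  have hdiff : IsRepresentable (T - R 0) := by
    refine isRepresentable_of_hasSum (U := fun n => R (n + 1) - R n) (C := 2 * 2) (fun n => ?_)
      (fun f => ?_) (by norm_num) fun f s => ?_
    · rw [sub_eq_add_neg, ← neg_one_smul ℂ (R n)]
      exact (hR _).add ((hR n).smul _)
    · have hs : Summable fun n => (R (n + 1) - R n) f :=
        .of_norm_bounded (hgeom.summable.mul_right ‖f‖) (hbound f)
      refine (hs.hasSum_iff_tendsto_nat).2 ?_
      simp only [sub_apply, Finset.sum_range_sub fun n => R n f]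
      exact (((ContinuousLinearMap.apply ℂ E f).continuous.tendsto T).comp hlim).sub_const _
    · refine (Finset.sum_le_sum fun n _ => hbound f n).trans ?_
      rw [← Finset.sum_mul]
      gcongr
      exact sum_le_hasSum s (fun _ _ => by positivity) hgeom
  simpa using hdiff.add (hR 0)

lemma clm_eq_of_eq_on_indicators {T S : L1C →L[ℂ] E}
    (h : ∀ a (ha : MeasurableSet a), T (indicatorConstLp 1 ha (measure_ne_top μ01 a) 1) =
      S (indicatorConstLp 1 ha (measure_ne_top μ01 a) 1)) : T = S := by
  ext f
  refine Lp.induction (p := 1) ENNReal.one_ne_top (fun f : L1C => T f = S f) ?_ ?_ ?_ f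
  · intro c a ha hμ
    have : (Lp.simpleFunc.indicatorConst 1 ha hμ.ne c : L1C) =
        c • indicatorConstLp 1 ha (measure_ne_top μ01 a) 1 := by
      rw [Lp.simpleFunc.coe_indicatorConst]
      refine Lp.ext ?_
      filter_upwards [indicatorConstLp_coeFn (p := 1) (hs := ha) (hμs := hμ.ne) (c := c),
        indicatorConstLp_coeFn (p := 1) (hs := ha) (hμs := hμ.ne) (c := (1 : ℂ)),
        Lp.coeFn_smul c (indicatorConstLp 1 ha (measure_ne_top μ01 a) (1 : ℂ))] with t h₁ h₂ h₃
      rw [h₁, h₃, Pi.smul_apply, h₂]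
      by_cases h' : t ∈ a <;> simp [h']
    rw [this, map_smul, map_smul, h a ha]
  · intro f g hf hg _ h₁ h₂
    rw [map_add, map_add, h₁, h₂]
  · exact isClosed_eq T.continuous S.continuous

end General

/-- Every bounded functional on `L₁[0,1]` has a density in `L∞[0,1]`. -/
lemma isRepresentable_functional (φ : L1C →L[ℂ] ℂ) : IsRepresentable φ := by
  let J : Lp ℂ 2 μ01 →L[ℂ] L1C := (ContinuousLinearMap.mul ℂ ℂ).holderL μ01 2 2 1
    (indicatorConstLp 2 MeasurableSet.univ (measure_ne_top μ01 _) 1)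
  have hJ : ∀ a (ha : MeasurableSet a), J (indicatorConstLp 2 ha (measure_ne_top μ01 a) 1) =
      indicatorConstLp 1 ha (measure_ne_top μ01 a) 1 := fun a ha => by
    refine Lp.ext ?_
    filter_upwards [(ContinuousLinearMap.mul ℂ ℂ).coeFn_holder (r := 1)
        (indicatorConstLp 2 MeasurableSet.univ (measure_ne_top μ01 _) (1 : ℂ))
        (indicatorConstLp 2 ha (measure_ne_top μ01 a) (1 : ℂ)),
      indicatorConstLp_coeFn (p := 2) (hs := MeasurableSet.univ)
        (hμs := measure_ne_top μ01 _) (c := (1 : ℂ)),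
      indicatorConstLp_coeFn (p := 2) (hs := ha) (hμs := measure_ne_top μ01 a) (c := (1 : ℂ)),
      indicatorConstLp_coeFn (p := 1) (hs := ha) (hμs := measure_ne_top μ01 a) (c := (1 : ℂ))]
      with t h₁ h₂ h₃ h₄
    refine h₁.trans ?_
    rw [h₂, h₃, h₄]
    simp
  let g : Lp ℂ 2 μ01 := (InnerProductSpace.toDual ℂ (Lp ℂ 2 μ01)).symm (φ.comp J)
  have hg : ∀ a (ha : MeasurableSet a), φ (indicatorConstLp 1 ha (measure_ne_top μ01 a) 1) =
      ∫ t in a, starRingEnd ℂ ((g : ℝ → ℂ) t) ∂μ01 := fun a ha => by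
    rw [integral_conj, ← L2.inner_indicatorConstLp_one ha (measure_ne_top μ01 a) g, inner_conj_symm,
      InnerProductSpace.toDual_symm_apply, ContinuousLinearMap.comp_apply, hJ a ha]
  have hgm : StronglyMeasurable fun t => starRingEnd ℂ ((g : ℝ → ℂ) t) :=
    RCLike.continuous_conj.comp_stronglyMeasurable (Lp.stronglyMeasurable g)
  have hgi : Integrable (fun t => starRingEnd ℂ ((g : ℝ → ℂ) t)) μ01 := by
    refine ((Lp.memLp g).integrable (by norm_num)).congr' hgm.aestronglyMeasurable ?_
    exact .of_forall fun t => (RCLike.norm_conj _).symm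
  have hb : ∀ᵐ t ∂μ01, ‖starRingEnd ℂ ((g : ℝ → ℂ) t)‖ ≤ ‖φ‖ := by
    have := ae_sum_norm_le_of_forall_setIntegral (ι := Unit)
      (h := fun _ t => starRingEnd ℂ ((g : ℝ → ℂ) t)) (fun _ => hgi) (norm_nonneg φ)
      fun a ha s => by
        rcases Finset.eq_empty_or_nonempty s with rfl | ⟨⟨⟩, hs⟩
        · rw [Finset.sum_empty]; positivity
        · rw [Finset.eq_singleton_iff_unique_mem.2 ⟨hs, fun _ _ => rfl⟩, Finset.sum_singleton]
          refine le_trans (le_of_eq ?_) (φ.le_opNorm_of_le (norm_indicatorConstLp_one_le ha))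
          rw [hg a ha]
    filter_upwards [this] with t ht
    simpa using ht {()}
  obtain ⟨ψ, hψ, -⟩ := exists_clm_of_density hgm.aestronglyMeasurable (norm_nonneg φ) hb
  have : φ = ψ := clm_eq_of_eq_on_indicators fun a ha => by
    rw [hψ, integral_indicatorConstLp_smul, one_smul, hg a ha]
  rw [this]
  exact isRepresentable_of_ae_bound hgm hb hψ

section Comp

variable {E : Type*} [NormedAddCommGroup E] [NormedSpace ℂ E] [CompleteSpace E]

/-- An operator with countably valued density `x ∘ idx`, precomposed with any operator. -/
lemma isRepresentable_comp_of_countably_valued {T : L1C →L[ℂ] E} {idx : ℝ → ℕ}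
    (hidx : Measurable idx) (x : ℕ → E) {C : ℝ} (hC0 : 0 ≤ C)
    (hC : ∀ᵐ t ∂μ01, ‖x (idx t)‖ ≤ C)
    (hT : ∀ f : L1C, T f = ∫ s, (f : ℝ → ℂ) s • x (idx s) ∂μ01) (S : L1C →L[ℂ] L1C) :
    IsRepresentable (T.comp S) := by
  have hm : ∀ n, MeasurableSet (idx ⁻¹' {n}) := fun n => hidx (measurableSet_singleton n)
  have hdisj : Pairwise (Function.onFun Disjoint fun n => idx ⁻¹' {n}) := fun i j hij =>
    Disjoint.preimage _ (Set.disjoint_singleton.2 hij)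
  have hx : AEStronglyMeasurable (fun t => x (idx t)) μ01 :=
    ((StronglyMeasurable.of_discrete (f := x)).comp_measurable hidx).aestronglyMeasurable
  have hφ : ∀ n, ∃ φ : L1C →L[ℂ] ℂ, ∀ f : L1C,
      φ f • x n = ∫ s in idx ⁻¹' {n}, (f : ℝ → ℂ) s • x (idx s) ∂μ01 := fun n => by
    obtain ⟨φ, hφ, -⟩ := exists_clm_of_density (E := ℂ)
      (h := (idx ⁻¹' {n}).indicator fun _ => 1)
      (stronglyMeasurable_const.indicator (hm n)).aestronglyMeasurable zero_le_one
      (.of_forall fun t => (norm_indicator_le_norm_self _ _).trans (by simp))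
    refine ⟨φ, fun f => ?_⟩
    have h₁ : φ f = ∫ s in idx ⁻¹' {n}, (f : ℝ → ℂ) s ∂μ01 := by
      rw [hφ, ← integral_indicator (hm n)]
      refine integral_congr_ae (.of_forall fun t => ?_)
      by_cases h' : t ∈ idx ⁻¹' {n} <;> simp [h']
    rw [h₁, ← integral_smul_const]
    refine setIntegral_congr_fun (hm n) fun t ht => ?_
    rw [show idx t = n from ht]
  choose φ hφ using hφ
  have hint : ∀ f : L1C, Integrable (fun s => (f : ℝ → ℂ) s • x (idx s)) μ01 :=
    integrable_L1C_smul hx hC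
  refine isRepresentable_of_hasSum (U := fun n => ((φ n).comp S).smulRight (x n))
    (C := C * ‖S‖) (fun n => ?_) (fun f => ?_) (by positivity) fun f s => ?_
  · have := (isRepresentable_functional ((φ n).comp S)).clm_comp
      ((ContinuousLinearMap.id ℂ ℂ).smulRight (x n))
    exact this
  · simp only [ContinuousLinearMap.smulRight_apply, ContinuousLinearMap.comp_apply, hφ, hT]
    have := hasSum_integral_iUnion hm hdisj (hint (S f)).integrableOn
    rwa [← Set.preimage_iUnion, Set.iUnion_of_singleton, Set.preimage_univ,
      setIntegral_univ] at this
  · simp only [ContinuousLinearMap.smulRight_apply, ContinuousLinearMap.comp_apply, hφ]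
    calc ∑ n ∈ s, ‖∫ t in idx ⁻¹' {n}, (S f : ℝ → ℂ) t • x (idx t) ∂μ01‖
        ≤ ∑ n ∈ s, ∫ t in idx ⁻¹' {n}, ‖(S f : ℝ → ℂ) t • x (idx t)‖ ∂μ01 :=
          Finset.sum_le_sum fun _ _ => norm_integral_le_integral_norm _
      _ = ∫ t in ⋃ n ∈ s, idx ⁻¹' {n}, ‖(S f : ℝ → ℂ) t • x (idx t)‖ ∂μ01 :=
          (integral_biUnion_finset s (fun n _ => hm n) (fun i _ j _ hij => hdisj hij)
            fun n _ => (hint (S f)).norm.integrableOn).symm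
      _ ≤ ∫ t, ‖(S f : ℝ → ℂ) t • x (idx t)‖ ∂μ01 :=
          setIntegral_le_integral (hint (S f)).norm (.of_forall fun _ => norm_nonneg _)
      _ ≤ ∫ t, C * ‖(S f : ℝ → ℂ) t‖ ∂μ01 := by
          refine integral_mono_ae (hint (S f)).norm
            ((L1.integrable_coeFn (S f)).norm.const_mul C) ?_
          filter_upwards [hC] with t ht
          rw [norm_smul, mul_comm]
          gcongr
      _ = C * ‖S f‖ := by rw [integral_const_mul, L1.norm_eq_integral_norm]
      _ ≤ C * ‖S‖ * ‖f‖ := by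
          rw [mul_assoc]
          exact mul_le_mul_of_nonneg_left (S.le_opNorm f) hC0

lemma IsRepresentable.comp_clm {T : L1C →L[ℂ] E} (hT : IsRepresentable T)
    (S : L1C →L[ℂ] L1C) : IsRepresentable (T.comp S) := by
  obtain ⟨h, hh, ⟨C, hC0, hC⟩, hT⟩ := hT.exists_ae_bound
  refine isClosed_setOf_isRepresentable.closure_subset (Metric.mem_closure_iff.2 fun ε hε => ?_)
  obtain ⟨δ, hδ, hδε⟩ : ∃ δ : ℝ, 0 < δ ∧ δ * ‖S‖ < ε := by
    refine ⟨ε / (‖S‖ + 1), by positivity, ?_⟩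
    rw [div_mul_eq_mul_div, div_lt_iff₀ (by positivity)]
    nlinarith
  obtain ⟨c, hc, hcd⟩ := hh.isSeparable_range
  obtain ⟨x, hx⟩ : ∃ x : ℕ → E, c ⊆ Set.range x := Set.countable_iff_exists_subset_range.1 hc
  have hfind : ∀ t, ∃ n, ‖h t - x n‖ < δ := fun t => by
    obtain ⟨y, hy, hd⟩ := Metric.mem_closure_iff.1 (hcd ⟨t, rfl⟩) δ hδ
    obtain ⟨n, rfl⟩ := hx hy
    exact ⟨n, by rwa [← dist_eq_norm]⟩
  classical
  let idx : ℝ → ℕ := fun t => Nat.find (hfind t)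
  have hidx : Measurable idx := measurable_find hfind fun n =>
    measurableSet_lt (hh.sub stronglyMeasurable_const).norm.measurable measurable_const
  have hclose : ∀ t, ‖h t - x (idx t)‖ ≤ δ := fun t => (Nat.find_spec (hfind t)).le
  have hxm : AEStronglyMeasurable (fun t => x (idx t)) μ01 :=
    ((StronglyMeasurable.of_discrete (f := x)).comp_measurable hidx).aestronglyMeasurable
  have hxC : ∀ᵐ t ∂μ01, ‖x (idx t)‖ ≤ C + δ := by
    filter_upwards [hC] with t ht
    have := norm_sub_norm_le (x (idx t)) (h t)
    have h₂ := hclose t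
    rw [norm_sub_rev] at h₂
    linarith
  obtain ⟨R, hR, -⟩ := exists_clm_of_density hxm (by positivity : 0 ≤ C + δ) hxC
  obtain ⟨V, hV, hVδ⟩ := exists_clm_of_density (hh.aestronglyMeasurable.sub hxm) hδ.le
    (.of_forall hclose)
  have hTR : T - R = V := by
    ext1 f
    rw [sub_apply, hT, hR, hV,
      ← integral_sub (integrable_L1C_smul hh.aestronglyMeasurable hC f)
        (integrable_L1C_smul hxm hxC f)]
    simp only [Pi.sub_apply, smul_sub]
  refine ⟨R.comp S,
    isRepresentable_comp_of_countably_valued hidx x (by positivity) hxC hR S, ?_⟩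
  rw [dist_eq_norm, ← ContinuousLinearMap.sub_comp, hTR]
  exact ((V.opNorm_comp_le S).trans (mul_le_mul_of_nonneg_right hVδ (norm_nonneg _))).trans_lt hδε

end Comp

/-- The set `𝔯` of representable operators on `L₁[0,1]` is a closed two-sided ideal of
`B(L₁[0,1])`: a norm-closed linear subspace which absorbs composition on both sides. -/
theorem representable_operators_closed_two_sided_ideal :
    IsClosed {T : L1C →L[ℂ] L1C | IsRepresentable T} ∧
    IsRepresentable (0 : L1C →L[ℂ] L1C) ∧
    (∀ T S : L1C →L[ℂ] L1C, IsRepresentable T → IsRepresentable S →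
      IsRepresentable (T + S)) ∧
    (∀ (c : ℂ) (T : L1C →L[ℂ] L1C), IsRepresentable T → IsRepresentable (c • T)) ∧
    (∀ T S : L1C →L[ℂ] L1C, IsRepresentable T →
      IsRepresentable (S.comp T) ∧ IsRepresentable (T.comp S)) := by
  exact ⟨isClosed_setOf_isRepresentable, isRepresentable_zero, fun _ _ hT hS => hT.add hS,
    fun c _ hT => hT.smul c, fun _ S hT => ⟨hT.clm_comp S, hT.comp_clm S⟩⟩
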